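/- Let B > 0 be a fixed constant. There exist constants c > 0, d₀ and k₀, depending only on B, such that for all d ≥ d₀ and all k ≥ k₀, the maximum-likelihood estimator θ̂⁽ᴮ⁾ (the unique minimizer of the negative log-likelihood ℓ over Θ_B) satisfies sup_{θ* ∈ Θ_B} ‖E[θ̂⁽ᴮ⁾] − θ*‖_∞ ≥ c/√(d·k). That is, the bias of the standard MLE is lower bounded by c/√(dk). -/

import Mathlib

open Finset

/-- The sigmoid (logistic) function `σ(x) = 1/(1+e^{-x})`. -/
noncomputable def sigmoid (x : ℝ) : ℝ := 1 / (1 + Real.exp (-x))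

/-- Probability that `Binomial(k, p) = w`. -/
noncomputable def binomProb (k : ℕ) (p : ℝ) (w : ℕ) : ℝ :=
  (k.choose w : ℝ) * p ^ w * (1 - p) ^ (k - w)

/-- Sample space for the league format: for each pair `i < j`, the number of wins
of item `i` over item `j` among the `k` comparisons of that pair. -/
abbrev BTLOutcome (d k : ℕ) := {q : Fin d × Fin d // q.1 < q.2} → Fin (k + 1)

/-- Joint probability of an outcome: independent `Binomial(k, σ(θ_i - θ_j))`
win counts across the pairs `i < j`. -/
noncomputable def outcomeProb (d k : ℕ) (θ : Fin d → ℝ) (w : BTLOutcome d k) : ℝ :=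
  ∏ q : {q : Fin d × Fin d // q.1 < q.2},
    binomProb k (sigmoid (θ q.1.1 - θ q.1.2)) (w q : ℕ)

/-- The full win-count matrix `W_ij` determined by an outcome (`W_ji = k - W_ij`). -/
def winCount (d k : ℕ) (w : BTLOutcome d k) (i j : Fin d) : ℕ :=
  if h : i < j then (w ⟨(i, j), h⟩ : ℕ)
  else if h' : j < i then k - (w ⟨(j, i), h'⟩ : ℕ)
  else 0

/-- The observed fraction of wins `μ_ij = W_ij / k`. -/
noncomputable def winFrac (d k : ℕ) (w : BTLOutcome d k) (i j : Fin d) : ℝ :=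
  (winCount d k w i j : ℝ) / (k : ℝ)

/-- The negative log-likelihood
`ℓ(θ) = k ∑_{i<j} [log(e^{θ_i}+e^{θ_j}) - μ_ij θ_i - μ_ji θ_j]`. -/
noncomputable def nll (d k : ℕ) (μ : Fin d → Fin d → ℝ) (θ : Fin d → ℝ) : ℝ :=
  (k : ℝ) * ∑ i : Fin d, ∑ j : Fin d,
    if i < j then
      Real.log (Real.exp (θ i) + Real.exp (θ j)) - μ i j * θ i - μ j i * θ j
    else 0

/-- The parameter domain `Θ_B = {θ : ‖θ‖_∞ ≤ B, ∑ θ_i = 0}`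
(the norm on `Fin d → ℝ` is the sup norm). -/
def paramSet (d : ℕ) (B : ℝ) : Set (Fin d → ℝ) :=
  {θ | ‖θ‖ ≤ B ∧ ∑ i, θ i = 0}

/-- The expectation (under true parameter `θ*`) of an estimator. -/
noncomputable def expVec (d k : ℕ) (θstar : Fin d → ℝ)
    (est : BTLOutcome d k → Fin d → ℝ) : Fin d → ℝ :=
  fun m => ∑ w : BTLOutcome d k, outcomeProb d k θstar w * est w m


lemma sigmoid_eq (x : ℝ) : sigmoid x = Real.sigmoid x := by
  simp [sigmoid, Real.sigmoid]

lemma hasDerivAt_sigmoid' (x : ℝ) :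
    HasDerivAt sigmoid (sigmoid x * (1 - sigmoid x)) x := by
  have h : sigmoid = Real.sigmoid := funext sigmoid_eq
  rw [h]
  exact Real.hasDerivAt_sigmoid x

lemma sigmoid_pos (x : ℝ) : 0 < sigmoid x := sigmoid_eq x ▸ Real.sigmoid_pos x

lemma sigmoid_lt_one (x : ℝ) : sigmoid x < 1 := sigmoid_eq x ▸ Real.sigmoid_lt_one x

lemma sigmoid_neg (x : ℝ) : sigmoid (-x) = 1 - sigmoid x := by
  simp [sigmoid_eq, Real.sigmoid_neg]

lemma sigmoid_deriv_le (x : ℝ) : sigmoid x * (1 - sigmoid x) ≤ 1 / 4 := by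
  nlinarith [sq_nonneg (sigmoid x - 1 / 2)]

lemma sigmoid_deriv_pos (x : ℝ) : 0 < sigmoid x * (1 - sigmoid x) :=
  mul_pos (sigmoid_pos x) (sub_pos.2 (sigmoid_lt_one x))

/-- On `[-R, R]` the derivative of the sigmoid is at least `σ(-R)²`. -/
lemma sq_le_sigmoid_deriv {R x : ℝ} (hx : |x| ≤ R) :
    sigmoid (-R) ^ 2 ≤ sigmoid x * (1 - sigmoid x) := by
  obtain ⟨h1, h2⟩ := abs_le.1 hx
  have a : sigmoid (-R) ≤ sigmoid x := by simpa only [sigmoid_eq] using Real.sigmoid_le h1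
  have b : sigmoid (-R) ≤ sigmoid (-x) := by
    simpa only [sigmoid_eq] using Real.sigmoid_le (neg_le_neg h2)
  rw [← sigmoid_neg, sq]
  exact mul_le_mul a b (sigmoid_pos _).le (sigmoid_pos _).le

lemma exists_sigmoid_sub_eq (x y : ℝ) : ∃ z, |z - x| ≤ |y - x| ∧ z ∈ Set.uIcc x y ∧
    sigmoid y - sigmoid x = sigmoid z * (1 - sigmoid z) * (y - x) := by
  have hc : Continuous sigmoid :=
    continuous_iff_continuousAt.2 fun x => (hasDerivAt_sigmoid' x).continuousAt
  suffices h : ∃ z ∈ Set.uIcc x y,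
      sigmoid y - sigmoid x = sigmoid z * (1 - sigmoid z) * (y - x) by
    obtain ⟨z, hz, h⟩ := h
    refine ⟨z, ?_, hz, h⟩
    exact Set.abs_sub_left_of_mem_uIcc hz
  rcases lt_trichotomy x y with h | h | h
  · obtain ⟨z, hz, hz'⟩ := exists_hasDerivAt_eq_slope sigmoid _ h hc.continuousOn
      fun z _ => hasDerivAt_sigmoid' z
    refine ⟨z, Set.Icc_subset_uIcc (Set.Ioo_subset_Icc_self hz), ?_⟩
    rw [hz', div_mul_cancel₀ _ (sub_pos.2 h).ne']
  · exact ⟨x, by simp, by simp [h]⟩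
  · obtain ⟨z, hz, hz'⟩ := exists_hasDerivAt_eq_slope sigmoid _ h hc.continuousOn
      fun z _ => hasDerivAt_sigmoid' z
    refine ⟨z, Set.Icc_subset_uIcc' (Set.Ioo_subset_Icc_self hz), ?_⟩
    have : x - y ≠ 0 := (sub_pos.2 h).ne'
    rw [hz']
    field_simp
    ring

lemma abs_sigmoid_sub_le (x y : ℝ) : |sigmoid y - sigmoid x| ≤ |y - x| / 4 := by
  obtain ⟨z, -, -, h⟩ := exists_sigmoid_sub_eq x y
  rw [h, abs_mul, abs_of_pos (sigmoid_deriv_pos z)]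
  nlinarith [sigmoid_deriv_le z, abs_nonneg (y - x)]

/-- Second-order Taylor lower bound for the sigmoid. -/
lemma sigmoid_taylor_lower (x h : ℝ) :
    sigmoid x * (1 - sigmoid x) * h - h ^ 2 / 4 ≤ sigmoid (x + h) - sigmoid x := by
  obtain ⟨z, hz, -, e⟩ := exists_sigmoid_sub_eq x (x + h)
  rw [e]
  simp only [add_sub_cancel_left] at hz ⊢
  have h1 : |sigmoid z * (1 - sigmoid z) - sigmoid x * (1 - sigmoid x)| ≤ |h| / 4 := by
    have : sigmoid z * (1 - sigmoid z) - sigmoid x * (1 - sigmoid x)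
        = (sigmoid z - sigmoid x) * (1 - sigmoid z - sigmoid x) := by ring
    rw [this, abs_mul]
    have h2 : |1 - sigmoid z - sigmoid x| ≤ 1 := by
      rw [abs_le]
      constructor <;> linarith [sigmoid_pos z, sigmoid_pos x, sigmoid_lt_one z, sigmoid_lt_one x]
    have := abs_sigmoid_sub_le x z
    nlinarith [abs_nonneg (sigmoid z - sigmoid x)]
  have h3 : |(sigmoid z * (1 - sigmoid z) - sigmoid x * (1 - sigmoid x)) * h| ≤ h ^ 2 / 4 := by
    rw [abs_mul, ← sq_abs h]
    nlinarith [abs_nonneg h]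
  linarith [(abs_le.1 h3).1]

/-- Strong monotonicity of the sigmoid on a bounded interval. -/
lemma sigmoid_strong_mono {R x y : ℝ} (hx : |x| ≤ R) (hy : |y| ≤ R) :
    sigmoid (-R) ^ 2 * (y - x) ^ 2 ≤ (sigmoid y - sigmoid x) * (y - x) := by
  obtain ⟨z, -, hz, e⟩ := exists_sigmoid_sub_eq x y
  have hzR : |z| ≤ R :=
    abs_le.2 (Set.uIcc_subset_Icc (abs_le.1 hx) (abs_le.1 hy) hz)
  rw [e, mul_assoc, ← sq]
  exact mul_le_mul_of_nonneg_right (sq_le_sigmoid_deriv hzR) (sq_nonneg _)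

section ProductExpectation

variable {ι κ : Type*} [Fintype ι] [DecidableEq ι] [Fintype κ] {P : ι → κ → ℝ}

lemma sum_prod_mul_apply (hP : ∀ q, ∑ x, P q x = 1) (r : ι) (f : κ → ℝ) :
    ∑ w : ι → κ, (∏ q, P q (w q)) * f (w r) = ∑ x, P r x * f x := by
  have h : ∀ w : ι → κ, (∏ q, P q (w q)) * f (w r)
      = ∏ q, P q (w q) * (if q = r then f (w q) else 1) := fun w => by
    rw [prod_mul_distrib]
    simp
  simp_rw [h]
  rw [← Fintype.prod_sum fun q x => P q x * (if q = r then f x else 1), prod_eq_single r]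
  · simp
  · intro b _ hb
    simp [hb, hP]
  · simp

lemma sum_prod_mul_apply_mul_apply {r s : ι} (hrs : r ≠ s) (f g : κ → ℝ)
    (hf : ∑ x, P r x * f x = 0) :
    ∑ w : ι → κ, (∏ q, P q (w q)) * (f (w r) * g (w s)) = 0 := by
  have h : ∀ w : ι → κ, (∏ q, P q (w q)) * (f (w r) * g (w s))
      = ∏ q, P q (w q) * ((if q = r then f (w q) else 1) * (if q = s then g (w q) else 1)) :=
    fun w => by
      rw [prod_mul_distrib, prod_mul_distrib]
      simp
  simp_rw [h]
  rw [← Fintype.prod_sum fun q x =>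
    P q x * ((if q = r then f x else 1) * (if q = s then g x else 1))]
  exact prod_eq_zero (mem_univ r) (by simpa [hrs] using hf)

/-- Second moment of a linear combination of independent centred variables. -/
lemma sum_prod_mul_sq (hP : ∀ q, ∑ x, P q x = 1) (e : ι → κ → ℝ)
    (he : ∀ q, ∑ x, P q x * e q x = 0) (a : ι → ℝ) :
    ∑ w : ι → κ, (∏ q, P q (w q)) * (∑ q, a q * e q (w q)) ^ 2
      = ∑ q, a q ^ 2 * ∑ x, P q x * e q x ^ 2 := by
  have h : ∀ w : ι → κ, (∏ q, P q (w q)) * (∑ q, a q * e q (w q)) ^ 2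
      = ∑ r, ∑ s, a r * a s * ((∏ q, P q (w q)) * (e r (w r) * e s (w s))) := fun w => by
    rw [sq, sum_mul_sum, mul_sum]
    refine sum_congr rfl fun r _ => ?_
    rw [mul_sum]
    exact sum_congr rfl fun s _ => by ring
  simp_rw [h]
  rw [sum_comm]
  refine sum_congr rfl fun r _ => ?_
  rw [sum_comm, sum_eq_single r]
  · rw [← mul_sum, ← sum_prod_mul_apply hP r fun x => e r x ^ 2]
    simp only [sq]
  · intro s _ hs
    rw [← mul_sum, sum_prod_mul_apply_mul_apply hs.symm _ _ (he r), mul_zero]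
  · simp

end ProductExpectation

section Binomial

lemma binomProb_eq_eval (k : ℕ) (p : ℝ) (w : ℕ) :
    binomProb k p w = (bernsteinPolynomial ℝ k w).eval p := by
  simp [binomProb, bernsteinPolynomial]

lemma binomProb_nonneg {k : ℕ} {p : ℝ} (h0 : 0 ≤ p) (h1 : p ≤ 1) (w : ℕ) :
    0 ≤ binomProb k p w := by
  have : 0 ≤ 1 - p := sub_nonneg.2 h1
  unfold binomProb
  positivity

lemma sum_binomProb (k : ℕ) (p : ℝ) : ∑ x : Fin (k + 1), binomProb k p x = 1 := by
  have := congrArg (Polynomial.eval p) (bernsteinPolynomial.sum ℝ k)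
  simpa [Polynomial.eval_finsetSum, sum_range, binomProb_eq_eval] using this

lemma sum_binomProb_mul (k : ℕ) (p : ℝ) :
    ∑ x : Fin (k + 1), binomProb k p x * (x : ℝ) = k * p := by
  have := congrArg (Polynomial.eval p) (bernsteinPolynomial.sum_smul ℝ k)
  simpa [Polynomial.eval_finsetSum, sum_range, binomProb_eq_eval, mul_comm] using this

lemma sum_binomProb_centered {k : ℕ} (hk : 0 < k) (p : ℝ) :
    ∑ x : Fin (k + 1), binomProb k p x * ((x : ℝ) / k - p) = 0 := by
  have hk' : (k : ℝ) ≠ 0 := by positivity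
  have h : ∀ x : Fin (k + 1), binomProb k p x * ((x : ℝ) / k - p)
      = binomProb k p x * (x : ℝ) / k - binomProb k p x * p := fun x => by ring
  simp_rw [h]
  rw [sum_sub_distrib, ← sum_div, ← sum_mul, sum_binomProb_mul, sum_binomProb]
  field_simp
  ring

lemma sum_binomProb_sq {k : ℕ} (hk : 0 < k) (p : ℝ) :
    ∑ x : Fin (k + 1), binomProb k p x * ((x : ℝ) / k - p) ^ 2 = p * (1 - p) / k := by
  have hk' : (k : ℝ) ≠ 0 := by positivity
  have := congrArg (Polynomial.eval p) (bernsteinPolynomial.variance ℝ k)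
  simp only [Polynomial.eval_finsetSum, sum_range, nsmul_eq_mul, Polynomial.eval_mul,
    Polynomial.eval_pow, Polynomial.eval_sub, Polynomial.eval_natCast, Polynomial.eval_X,
    Polynomial.eval_one, ← binomProb_eq_eval] at this
  have h : ∀ x : Fin (k + 1), binomProb k p x * ((x : ℝ) / k - p) ^ 2
      = (k * p - (x : ℝ)) ^ 2 * binomProb k p x / k ^ 2 := fun x => by
    field_simp
    ring
  simp_rw [h]
  rw [← sum_div, this]
  field_simp

open Complex in
lemma norm_charFun_bernoulli_le {p m u : ℝ} (hm0 : 0 ≤ m) (hm : m ≤ p * (1 - p)) (hu : |u| ≤ Real.pi) :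
    ‖(p : ℂ) * exp (u * I) + (1 - p)‖ ≤ Real.exp (-(2 * m / Real.pi ^ 2 * u ^ 2)) := by
  have h1 : ‖(p : ℂ) * exp (u * I) + (1 - p)‖ ^ 2 = 1 - 2 * (p * (1 - p)) * (1 - Real.cos u) := by
    rw [← normSq_eq_norm_sq, normSq_apply]
    simp [exp_ofReal_mul_I_re, exp_ofReal_mul_I_im]
    linear_combination p ^ 2 * Real.sin_sq_add_cos_sq u
  have h2 := Real.cos_le_one_sub_mul_cos_sq hu
  have h3 : ‖(p : ℂ) * exp (u * I) + (1 - p)‖ ^ 2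
      ≤ Real.exp (-(2 * m / Real.pi ^ 2 * u ^ 2)) ^ 2 := by
    rw [h1, ← Real.exp_nat_mul]
    refine le_trans ?_ (Real.add_one_le_exp _)
    have hc : 0 ≤ 1 - Real.cos u := sub_nonneg.2 (Real.cos_le_one u)
    have h4 : m * (2 / Real.pi ^ 2 * u ^ 2) ≤ p * (1 - p) * (1 - Real.cos u) :=
      mul_le_mul hm (by linarith) (by positivity) (hm0.trans hm)
    have h5 : 2 * m / Real.pi ^ 2 * u ^ 2 = m * (2 / Real.pi ^ 2 * u ^ 2) := by ring
    push_cast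
    rw [h5]
    linarith
  exact (pow_le_pow_iff_left₀ (norm_nonneg _) (Real.exp_pos _).le two_ne_zero).1 h3

open Complex in
lemma sum_binomProb_charFun (k : ℕ) (p u : ℝ) :
    ‖∑ x : Fin (k + 1), (binomProb k p x : ℂ) * exp (((u * (x - k * p) : ℝ) : ℂ) * I)‖
      = ‖(p : ℂ) * exp (u * I) + (1 - p)‖ ^ k := by
  have h : ∀ x : Fin (k + 1), (binomProb k p x : ℂ) * exp (((u * (x - k * p) : ℝ) : ℂ) * I)
      = exp (((-(u * (k * p)) : ℝ) : ℂ) * I) *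
        ((p * exp (u * I)) ^ (x : ℕ) * (1 - p : ℂ) ^ (k - x) * (k.choose x : ℕ)) := fun x => by
    have : exp (((u * (x - k * p) : ℝ) : ℂ) * I)
        = exp (((-(u * (k * p)) : ℝ) : ℂ) * I) * exp (u * I) ^ (x : ℕ) := by
      rw [← exp_nat_mul, ← exp_add]
      push_cast
      ring_nf
    rw [this, mul_pow, binomProb]
    push_cast
    ring
  simp_rw [h]
  rw [← mul_sum, norm_mul, norm_exp_ofReal_mul_I, one_mul, ← norm_pow, add_pow, sum_range]

variable {ι : Type*} [Fintype ι] [DecidableEq ι]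

open Complex in
/-- First absolute moment of a sum of independent centred binomials. -/
lemma le_sum_prod_binomProb_abs {k : ℕ} (hk : 0 < k) {p : ι → ℝ} (h0 : ∀ q, 0 ≤ p q)
    (h1 : ∀ q, p q ≤ 1) {Q : Finset ι} (hQ : Q.Nonempty) {m : ℝ} (hm0 : 0 ≤ m)
    (hm : ∀ q ∈ Q, m ≤ p q * (1 - p q)) :
    √(#Q * k) * (1 - Real.exp (-(2 * m / Real.pi ^ 2))) ≤
      ∑ w : ι → Fin (k + 1), (∏ q, binomProb k (p q) (w q)) *
        |∑ q ∈ Q, ((w q : ℝ) - k * p q)| := by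
  have hN : (0 : ℝ) < #Q * k := by
    have := hQ.card_pos
    positivity
  set u : ℝ := 1 / √(#Q * k) with hu
  have hu0 : 0 < u := by positivity
  have hu2 : u ^ 2 * (#Q * k) = 1 := by
    rw [hu, div_pow, Real.sq_sqrt hN.le]
    field_simp
  have hu1 : |u| ≤ Real.pi := by
    rw [abs_of_pos hu0]
    have h3 : (1 : ℝ) ≤ #Q * k := by
      exact_mod_cast Nat.mul_pos hQ.card_pos hk
    have : u ≤ 1 := by nlinarith
    linarith [Real.pi_gt_three]
  set W : (ι → Fin (k + 1)) → ℝ := fun w => ∏ q, binomProb k (p q) (w q) with hW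
  have hW0 : ∀ w, 0 ≤ W w := fun w => prod_nonneg fun q _ => binomProb_nonneg (h0 q) (h1 q) _
  have hW1 : ∑ w, W w = 1 := by
    rw [hW, ← Fintype.prod_sum fun q (x : Fin (k + 1)) => binomProb k (p q) x]
    simp [sum_binomProb]
  set T : (ι → Fin (k + 1)) → ℝ := fun w => ∑ q ∈ Q, ((w q : ℝ) - k * p q) with hT
  have hchar : ‖∑ w, (W w : ℂ) * exp (((u * T w : ℝ) : ℂ) * I)‖
      ≤ Real.exp (-(2 * m / Real.pi ^ 2)) := by
    have h : ∀ w : ι → Fin (k + 1), (W w : ℂ) * exp (((u * T w : ℝ) : ℂ) * I)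
        = ∏ q, (binomProb k (p q) (w q) : ℂ) *
          (if q ∈ Q then exp (((u * (w q - k * p q) : ℝ) : ℂ) * I) else 1) := fun w => by
      rw [prod_mul_distrib, prod_ite_mem, univ_inter, ← exp_sum, ← sum_mul, hT, hW]
      push_cast
      rw [mul_sum]
    simp_rw [h]
    rw [← Fintype.prod_sum fun q (x : Fin (k + 1)) => (binomProb k (p q) x : ℂ) *
          (if q ∈ Q then exp (((u * (x - k * p q) : ℝ) : ℂ) * I) else 1), norm_prod]
    calc _ ≤ ∏ q, (if q ∈ Q then Real.exp (-(2 * m / Real.pi ^ 2 * u ^ 2)) ^ k else 1) := by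
          refine prod_le_prod (fun _ _ => norm_nonneg _) fun q _ => ?_
          split_ifs with hq
          · rw [sum_binomProb_charFun]
            exact pow_le_pow_left₀ (norm_nonneg _) (norm_charFun_bernoulli_le hm0 (hm q hq) hu1) _
          · simp only [mul_one]
            rw [← ofReal_sum, sum_binomProb]
            simp
      _ = Real.exp (-(2 * m / Real.pi ^ 2)) := by
          rw [prod_ite_mem, univ_inter, prod_const, ← Real.exp_nat_mul, ← Real.exp_nat_mul]
          congr 1
          linear_combination (-(2 * m / Real.pi ^ 2)) * hu2
  have hcos : ∑ w, W w * Real.cos (u * T w) ≤ Real.exp (-(2 * m / Real.pi ^ 2)) := by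
    refine le_trans (le_of_eq ?_) ((re_le_norm _).trans hchar)
    rw [re_sum]
    refine sum_congr rfl fun w _ => ?_
    rw [re_ofReal_mul, exp_ofReal_mul_I_re]
  have habs : ∀ w, W w * 1 - W w * Real.cos (u * T w) ≤ u * (W w * |T w|) := fun w => by
    have h4 : 1 - Real.cos (u * T w) ≤ u * |T w| := by
      have h5 := Real.one_sub_sq_div_two_le_cos (x := u * T w)
      have h6 := Real.neg_one_le_cos (u * T w)
      have h7 : (u * T w) ^ 2 = (u * |T w|) ^ 2 := by rw [mul_pow, mul_pow, sq_abs]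
      have h8 : 0 ≤ u * |T w| := by positivity
      rcases le_total (u * |T w|) 2 with h | h
      · nlinarith
      · linarith
    nlinarith [hW0 w]
  have hsum := sum_le_sum fun w (_ : w ∈ univ) => habs w
  rw [sum_sub_distrib, ← sum_mul, hW1, ← mul_sum] at hsum
  have h9 : √(#Q * k) * u = 1 := by
    rw [hu]
    field_simp
  calc _ ≤ √(#Q * k) * (u * ∑ w, W w * |T w|) := by
        gcongr
        linarith
    _ = _ := by rw [← mul_assoc, h9, one_mul]

end Binomial

section Pairs

variable {d n : ℕ}

lemma sum_pairs (f : Fin d → Fin d → ℝ) :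
    ∑ q : {q : Fin d × Fin d // q.1 < q.2}, f q.1.1 q.1.2
      = ∑ i, ∑ j, if i < j then f i j else 0 := by
  rw [← Fintype.sum_prod_type' fun i j => if i < j then f i j else 0,
    ← sum_filter fun q : Fin d × Fin d => q.1 < q.2]
  exact (sum_subtype _ (by simp) fun q : Fin d × Fin d => f q.1 q.2).symm

lemma sum_pairs_first_eq_zero (f : Fin (n + 1) → Fin (n + 1) → ℝ) :
    ∑ q : {q : Fin (n + 1) × Fin (n + 1) // q.1 < q.2},
      (if q.1.1 = 0 then f q.1.1 q.1.2 else 0) = ∑ j : Fin n, f 0 j.succ := by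
  rw [sum_pairs fun i j => if i = 0 then f i j else 0, Fin.sum_univ_succ, Fin.sum_univ_succ]
  simp [Fin.succ_ne_zero]

lemma sum_pairs_sq_sub (δ : Fin d → ℝ) (hδ : ∑ i, δ i = 0) :
    ∑ q : {q : Fin d × Fin d // q.1 < q.2}, (δ q.1.1 - δ q.1.2) ^ 2 = d * ∑ i, δ i ^ 2 := by
  have h1 : ∑ i, ∑ j, (δ i - δ j) ^ 2 = 2 * (d * ∑ i, δ i ^ 2) := by
    have h : ∀ i j, (δ i - δ j) ^ 2 = δ i ^ 2 + δ j ^ 2 - 2 * δ i * δ j := fun i j => by ring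
    simp_rw [h, sum_sub_distrib, sum_add_distrib, ← mul_sum, hδ]
    simp [← mul_sum]
    ring
  have h2 : ∑ i, ∑ j, (δ i - δ j) ^ 2
      = (∑ i, ∑ j, if i < j then (δ i - δ j) ^ 2 else 0)
        + ∑ i, ∑ j, if j < i then (δ i - δ j) ^ 2 else 0 := by
    simp_rw [← sum_add_distrib]
    refine sum_congr rfl fun i _ => sum_congr rfl fun j _ => ?_
    rcases lt_trichotomy i j with h | h | h
    · simp [h, h.not_gt]
    · simp [h]
    · simp [h, h.not_gt]
  have h3 : (∑ i, ∑ j, if j < i then (δ i - δ j) ^ 2 else 0)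
      = ∑ i, ∑ j, if i < j then (δ i - δ j) ^ 2 else 0 := by
    rw [sum_comm]
    refine sum_congr rfl fun i _ => sum_congr rfl fun j _ => ?_
    rw [sub_sq_comm]
  rw [sum_pairs fun i j => (δ i - δ j) ^ 2]
  linarith

end Pairs

section FirstOrder

variable {d k : ℕ} {B : ℝ}

lemma paramSet_add_smul_mem {θ θ' : Fin d → ℝ} (hθ : θ ∈ paramSet d B) (hθ' : θ' ∈ paramSet d B)
    {t : ℝ} (h0 : 0 ≤ t) (h1 : t ≤ 1) : θ + t • (θ' - θ) ∈ paramSet d B := by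
  refine ⟨?_, ?_⟩
  · have : θ + t • (θ' - θ) = (1 - t) • θ + t • θ' := by module
    rw [this]
    calc _ ≤ ‖(1 - t) • θ‖ + ‖t • θ'‖ := norm_add_le _ _
      _ = (1 - t) * ‖θ‖ + t * ‖θ'‖ := by
        rw [norm_smul, norm_smul, Real.norm_of_nonneg h0, Real.norm_of_nonneg (sub_nonneg.2 h1)]
      _ ≤ (1 - t) * B + t * B := by
        have := sub_nonneg.2 h1
        gcongr
        exacts [hθ.1, hθ'.1]
      _ = B := by ring
  · simp [sum_add_distrib, ← mul_sum, hθ.2, hθ'.2]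

lemma winFrac_of_lt (w : BTLOutcome d k) (q : {q : Fin d × Fin d // q.1 < q.2}) :
    winFrac d k w q.1.1 q.1.2 = (w q : ℝ) / k := by
  simp [winFrac, winCount, q.2]

lemma winFrac_of_gt (hk : 0 < k) (w : BTLOutcome d k) (q : {q : Fin d × Fin d // q.1 < q.2}) :
    winFrac d k w q.1.2 q.1.1 = 1 - (w q : ℝ) / k := by
  have hk' : (k : ℝ) ≠ 0 := by positivity
  have h : (w q : ℕ) ≤ k := Nat.lt_succ_iff.1 (w q).2
  simp only [winFrac, winCount, q.2, q.2.not_gt, dite_true, dite_false]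
  rw [Nat.cast_sub h]
  field_simp

lemma hasDerivAt_nll_line (hk : 0 < k) (w : BTLOutcome d k) (θ v : Fin d → ℝ) :
    HasDerivAt (fun t : ℝ => nll d k (winFrac d k w) (θ + t • v))
      (k * ∑ q : {q : Fin d × Fin d // q.1 < q.2},
        (sigmoid (θ q.1.1 - θ q.1.2) - (w q : ℝ) / k) * (v q.1.1 - v q.1.2)) 0 := by
  unfold nll
  simp_rw [← sum_pairs]
  refine HasDerivAt.const_mul _ (HasDerivAt.fun_sum fun q _ => ?_)
  rw [winFrac_of_lt, winFrac_of_gt hk]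
  have hl : ∀ i, HasDerivAt (fun t : ℝ => (θ + t • v) i) (v i) 0 := fun i => by
    simpa using ((hasDerivAt_id (0 : ℝ)).mul_const (v i)).const_add (θ i)
  have hpos : Real.exp ((θ + (0 : ℝ) • v) q.1.1) + Real.exp ((θ + (0 : ℝ) • v) q.1.2) ≠ 0 := by
    positivity
  refine (((((hl q.1.1).exp.fun_add (hl q.1.2).exp).log hpos).fun_sub
    ((hl q.1.1).const_mul ((w q : ℝ) / k))).fun_sub
      ((hl q.1.2).const_mul (1 - (w q : ℝ) / k))).congr_deriv ?_
  have hs : sigmoid (θ q.1.1 - θ q.1.2)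
      = Real.exp (θ q.1.1) / (Real.exp (θ q.1.1) + Real.exp (θ q.1.2)) := by
    rw [sigmoid, neg_sub, Real.exp_sub]
    field_simp
  rw [hs]
  simp only [zero_smul, add_zero]
  field_simp
  ring

/-- First-order optimality over the convex set `paramSet d B`. -/
lemma variational_inequality (hk : 0 < k) {w : BTLOutcome d k} {θ : Fin d → ℝ}
    (hθ : θ ∈ paramSet d B)
    (hmin : ∀ θ' ∈ paramSet d B, nll d k (winFrac d k w) θ ≤ nll d k (winFrac d k w) θ')
    {θ' : Fin d → ℝ} (hθ' : θ' ∈ paramSet d B) :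
    0 ≤ ∑ q : {q : Fin d × Fin d // q.1 < q.2},
      (sigmoid (θ q.1.1 - θ q.1.2) - (w q : ℝ) / k) *
        ((θ' q.1.1 - θ q.1.1) - (θ' q.1.2 - θ q.1.2)) := by
  have hd := (hasDerivAt_nll_line hk w θ (θ' - θ)).tendsto_slope_zero_right
  have h : 0 ≤ (k : ℝ) * ∑ q : {q : Fin d × Fin d // q.1 < q.2},
      (sigmoid (θ q.1.1 - θ q.1.2) - (w q : ℝ) / k) *
        ((θ' - θ) q.1.1 - (θ' - θ) q.1.2) := by
    refine ge_of_tendsto hd ?_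
    filter_upwards [Ioc_mem_nhdsGT (zero_lt_one' ℝ)] with t ht
    have := hmin _ (paramSet_add_smul_mem hθ hθ' ht.1.le ht.2)
    simp only [zero_add, zero_smul, add_zero, smul_eq_mul]
    exact mul_nonneg (inv_nonneg.2 ht.1.le) (sub_nonneg.2 this)
  exact nonneg_of_mul_nonneg_right h (by positivity)

lemma sum_pairs_first_eq_zero_nonpos {n : ℕ} (hn : 0 < n) (hk : 0 < k)
    {w : BTLOutcome (n + 1) k} {θ : Fin (n + 1) → ℝ} (hθ : θ ∈ paramSet (n + 1) B)
    (hmin : ∀ θ' ∈ paramSet (n + 1) B,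
      nll (n + 1) k (winFrac (n + 1) k w) θ ≤ nll (n + 1) k (winFrac (n + 1) k w) θ')
    {η : ℝ} (hη : 0 < η) (h0 : -B + η ≤ θ 0) (hj : ∀ j : Fin n, θ j.succ ≤ B - η) :
    ∑ q : {q : Fin (n + 1) × Fin (n + 1) // q.1 < q.2},
      (if q.1.1 = 0 then sigmoid (θ q.1.1 - θ q.1.2) - (w q : ℝ) / k else 0) ≤ 0 := by
  have hn' : (0 : ℝ) < n := by positivity
  have hn1 : (1 : ℝ) ≤ n := by exact_mod_cast hn
  have hηn : η / n ≤ η := div_le_self hη.le hn1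
  have hηn0 : 0 < η / n := by positivity
  have hB : 0 ≤ B := (norm_nonneg θ).trans hθ.1
  have hb : ∀ i, |θ i| ≤ B := fun i => (norm_le_pi_norm θ i).trans hθ.1
  set θ' : Fin (n + 1) → ℝ := Fin.cons (θ 0 - η) fun j => θ j.succ + η / n with hθ'
  have hmem : θ' ∈ paramSet (n + 1) B := by
    refine ⟨(pi_norm_le_iff_of_nonneg hB).2 fun i => ?_, ?_⟩
    · rw [Real.norm_eq_abs, abs_le]
      refine Fin.cases ?_ (fun j => ?_) i
      · simp only [hθ', Fin.cons_zero]
        constructor <;> linarith [(abs_le.1 (hb 0)).2]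
      · simp only [hθ', Fin.cons_succ]
        constructor <;> linarith [(abs_le.1 (hb j.succ)).1, hj j]
    · have := hθ.2
      rw [Fin.sum_univ_succ] at this ⊢
      simp only [hθ', Fin.cons_zero, Fin.cons_succ, sum_add_distrib, sum_const, card_univ,
        Fintype.card_fin, nsmul_eq_mul]
      rw [mul_div_cancel₀ _ hn'.ne']
      linarith
  have hv := variational_inequality hk hθ hmin hmem
  have he : ∀ q : {q : Fin (n + 1) × Fin (n + 1) // q.1 < q.2},
      (sigmoid (θ q.1.1 - θ q.1.2) - (w q : ℝ) / k) *
        ((θ' q.1.1 - θ q.1.1) - (θ' q.1.2 - θ q.1.2))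
      = -(η + η / n) *
        (if q.1.1 = 0 then sigmoid (θ q.1.1 - θ q.1.2) - (w q : ℝ) / k else 0) := by
    intro q
    have hs : ∀ i ≠ 0, θ' i = θ i + η / n := fun i hi => by
      obtain ⟨j, rfl⟩ := Fin.exists_succ_eq.2 hi
      simp [hθ']
    rw [hs q.1.2 (Fin.ne_zero_of_lt q.2)]
    by_cases h : q.1.1 = 0
    · simp only [h, hθ', Fin.cons_zero, if_true]
      ring
    · simp only [h, hs q.1.1 h, if_false]
      ring
  simp_rw [he] at hv
  rw [← mul_sum] at hv
  nlinarith

end FirstOrder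

/-- Deviation of the observed win fraction of a pair from its mean. -/
noncomputable def winNoise (d k : ℕ) (θ : Fin d → ℝ) (w : BTLOutcome d k)
    (q : {q : Fin d × Fin d // q.1 < q.2}) : ℝ :=
  (w q : ℝ) / k - sigmoid (θ q.1.1 - θ q.1.2)

/-- Signed incidence of item `i` in the pair `q`. -/
noncomputable def incidence {d : ℕ} (i : Fin d) (q : {q : Fin d × Fin d // q.1 < q.2}) : ℝ :=
  (if q.1.1 = i then 1 else 0) - (if q.1.2 = i then 1 else 0)

/-- The normalized score (negative gradient of the negative log-likelihood divided by `k`). -/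
noncomputable def score (d k : ℕ) (θ : Fin d → ℝ) (w : BTLOutcome d k) (i : Fin d) : ℝ :=
  ∑ q, incidence i q * winNoise d k θ w q

section Score

variable {d n k : ℕ} {B : ℝ}

lemma sum_winNoise_mul_sub (θ δ : Fin d → ℝ) (w : BTLOutcome d k) :
    ∑ q, winNoise d k θ w q * (δ q.1.1 - δ q.1.2) = ∑ i, δ i * score d k θ w i := by
  simp_rw [score, mul_sum]
  rw [sum_comm]
  refine sum_congr rfl fun q _ => ?_
  have h : ∀ i, δ i * (incidence i q * winNoise d k θ w q)
      = (if q.1.1 = i then δ i * winNoise d k θ w q else 0)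
        - (if q.1.2 = i then δ i * winNoise d k θ w q else 0) := fun i => by
    unfold incidence
    split_ifs <;> ring
  simp_rw [h]
  rw [sum_sub_distrib, sum_ite_eq, sum_ite_eq]
  simp
  ring

lemma score_zero (θ : Fin (n + 1) → ℝ) (w : BTLOutcome (n + 1) k) :
    score (n + 1) k θ w 0 = ∑ q, if q.1.1 = 0 then winNoise (n + 1) k θ w q else 0 := by
  refine sum_congr rfl fun q _ => ?_
  have := Fin.ne_zero_of_lt q.2
  simp [incidence, this]

lemma abs_sub_le_of_mem_paramSet {θ : Fin d → ℝ} (hθ : θ ∈ paramSet d B) (i j : Fin d) :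
    |θ i - θ j| ≤ 2 * B := by
  have hb : ∀ i, |θ i| ≤ B := fun i => (norm_le_pi_norm θ i).trans hθ.1
  linarith [abs_sub (θ i) (θ j), hb i, hb j]

/-- Deterministic `ℓ²` error bound for the constrained maximum-likelihood estimator. -/
lemma sum_sq_sub_le_score (hk : 0 < k) {w : BTLOutcome d k} {θ θs : Fin d → ℝ}
    (hθ : θ ∈ paramSet d B) (hθs : θs ∈ paramSet d B)
    (hmin : ∀ θ' ∈ paramSet d B, nll d k (winFrac d k w) θ ≤ nll d k (winFrac d k w) θ') :
    (sigmoid (-(2 * B)) ^ 2 * d) ^ 2 * ∑ i, (θ i - θs i) ^ 2 ≤ ∑ i, score d k θs w i ^ 2 := by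
  have hv := variational_inequality hk hθ hmin hθs
  set δ : Fin d → ℝ := fun i => θ i - θs i with hδ
  have hδ0 : ∑ i, δ i = 0 := by
    simp [hδ, hθ.2, hθs.2]
  set m := sigmoid (-(2 * B)) ^ 2 with hm
  have h1 : ∀ q : {q : Fin d × Fin d // q.1 < q.2},
      m * (δ q.1.1 - δ q.1.2) ^ 2 ≤ winNoise d k θs w q * (δ q.1.1 - δ q.1.2)
        - (sigmoid (θ q.1.1 - θ q.1.2) - (w q : ℝ) / k) *
        ((θs q.1.1 - θ q.1.1) - (θs q.1.2 - θ q.1.2)) := fun q => by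
    have h := sigmoid_strong_mono (abs_sub_le_of_mem_paramSet hθs q.1.1 q.1.2)
      (abs_sub_le_of_mem_paramSet hθ q.1.1 q.1.2)
    simp only [winNoise, hδ]
    rw [← hm] at h
    linarith
  have h2 := sum_le_sum fun q (_ : q ∈ univ) => h1 q
  rw [← mul_sum, sum_sub_distrib, sum_pairs_sq_sub δ hδ0, sum_winNoise_mul_sub] at h2
  have h3 := sum_mul_sq_le_sq_mul_sq univ δ fun i => score d k θs w i
  have hN : 0 ≤ ∑ i, δ i ^ 2 := sum_nonneg fun i _ => sq_nonneg _
  have h4 : m * d * ∑ i, δ i ^ 2 ≤ ∑ i, δ i * score d k θs w i := by linarith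
  have h5 : (m * d * ∑ i, δ i ^ 2) ^ 2 ≤ (∑ i, δ i * score d k θs w i) ^ 2 :=
    pow_le_pow_left₀ (by positivity) h4 2
  rcases hN.eq_or_lt with h | h
  · change _ * ∑ i, δ i ^ 2 ≤ _
    rw [← h, mul_zero]
    exact sum_nonneg fun i _ => sq_nonneg _
  · refine le_of_mul_le_mul_left ?_ h
    calc _ = (m * d * ∑ i, δ i ^ 2) ^ 2 := by ring
      _ ≤ _ := h5.trans h3

/-- The parameter whose first coordinate is `B`, all the others being equal. -/
noncomputable def cornerParam (n : ℕ) (B : ℝ) : Fin (n + 1) → ℝ :=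
  Fin.cons B fun _ => -(B / n)

lemma cornerParam_mem (hn : 0 < n) (hB : 0 ≤ B) : cornerParam n B ∈ paramSet (n + 1) B := by
  have hn' : (0 : ℝ) < n := by positivity
  have hn1 : (1 : ℝ) ≤ n := by exact_mod_cast hn
  refine ⟨(pi_norm_le_iff_of_nonneg hB).2 fun i => ?_, ?_⟩
  · rw [Real.norm_eq_abs]
    refine Fin.cases ?_ (fun j => ?_) i
    · simp [cornerParam, abs_of_nonneg hB]
    · have : 0 ≤ B / n := by positivity
      simp only [cornerParam, Fin.cons_succ, abs_neg, abs_of_nonneg this]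
      exact div_le_self hB hn1
  · rw [Fin.sum_univ_succ]
    simp only [cornerParam, Fin.cons_zero, Fin.cons_succ, sum_const, card_univ,
      Fintype.card_fin, nsmul_eq_mul]
    field_simp
    ring

/-- If the estimate is near the corner parameter, a deficit of wins of the first item forces a
deficit of its estimated parameter. -/
lemma neg_score_zero_le (hn : 0 < n) (hk : 0 < k) (hB : 0 < B) {w : BTLOutcome (n + 1) k}
    {θ : Fin (n + 1) → ℝ} (hθ : θ ∈ paramSet (n + 1) B)
    (hmin : ∀ θ' ∈ paramSet (n + 1) B,
      nll (n + 1) k (winFrac (n + 1) k w) θ ≤ nll (n + 1) k (winFrac (n + 1) k w) θ')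
    (hN : ∑ i, (θ i - cornerParam n B i) ^ 2 ≤ B ^ 2 / 4) :
    -score (n + 1) k (cornerParam n B) w 0 ≤ (1 + 2 * B) / 4 * (n + 1) * (B - θ 0)
      + (∑ i, (θ i - cornerParam n B i) ^ 2) / 4 := by
  set θs := cornerParam n B with hθs
  have hs := cornerParam_mem hn hB.le
  rw [← hθs] at hs
  have hθs0 : θs 0 = B := rfl
  have hθsj : ∀ j : Fin n, θs j.succ = -(B / n) := fun j => rfl
  have hBn : 0 ≤ B / n := by positivity
  have hnear : ∀ i, |θ i - θs i| ≤ B / 2 := fun i => by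
    refine abs_le_of_sq_le_sq ?_ (by positivity)
    have := single_le_sum (f := fun i => (θ i - θs i) ^ 2) (fun i _ => sq_nonneg _) (mem_univ i)
    linarith
  have hg := sum_pairs_first_eq_zero_nonpos hn hk hθ hmin (η := B / 2) (by positivity)
    (by have := (abs_le.1 (hnear 0)).1; rw [hθs0] at this; linarith)
    (fun j => by have := (abs_le.1 (hnear j.succ)).2; rw [hθsj] at this; linarith)
  have hX : 0 ≤ B - θ 0 := sub_nonneg.2 ((abs_le.1 ((norm_le_pi_norm θ 0).trans hθ.1)).2)
  have hX2 : B - θ 0 ≤ 2 * B := by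
    linarith [(abs_le.1 ((norm_le_pi_norm θ 0).trans hθ.1)).1]
  have h1 : ∑ j : Fin n, (sigmoid (θ 0 - θ j.succ) - sigmoid (θs 0 - θs j.succ))
      ≤ score (n + 1) k θs w 0 := by
    rw [score_zero, ← sum_pairs_first_eq_zero
      fun i j => sigmoid (θ i - θ j) - sigmoid (θs i - θs j), ← sub_nonpos, ← sum_sub_distrib]
    refine le_trans (le_of_eq (sum_congr rfl fun q _ => ?_)) hg
    simp only [winNoise]
    split_ifs <;> ring
  set δ : Fin (n + 1) → ℝ := fun i => θ i - θs i with hδ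
  have hδ0 : δ 0 + ∑ j : Fin n, δ j.succ = 0 := by
    rw [← Fin.sum_univ_succ]
    simp [hδ, hθ.2, hs.2]
  set s := sigmoid (B + B / n) * (1 - sigmoid (B + B / n)) with hs'
  have h2 : ∑ j : Fin n, (s * (δ 0 - δ j.succ) - (δ 0 - δ j.succ) ^ 2 / 4)
      ≤ ∑ j : Fin n, (sigmoid (θ 0 - θ j.succ) - sigmoid (θs 0 - θs j.succ)) := by
    refine sum_le_sum fun j _ => ?_
    have h := sigmoid_taylor_lower (B + B / n) (δ 0 - δ j.succ)
    have e1 : B + B / n + (δ 0 - δ j.succ) = θ 0 - θ j.succ := by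
      simp only [hδ, hθs0, hθsj]
      ring
    have e2 : θs 0 - θs j.succ = B + B / n := by
      rw [hθs0, hθsj]
      ring
    rw [e1] at h
    rw [e2]
    exact h
  have h3 : ∑ j : Fin n, (s * (δ 0 - δ j.succ) - (δ 0 - δ j.succ) ^ 2 / 4)
      = s * ((n + 1) * δ 0) - ((n + 1) * δ 0 ^ 2 + ∑ i, δ i ^ 2) / 4 := by
    have e : ∀ j : Fin n, s * (δ 0 - δ j.succ) - (δ 0 - δ j.succ) ^ 2 / 4
        = (s * δ 0 - δ 0 ^ 2 / 4) - (s - δ 0 / 2) * δ j.succ - δ j.succ ^ 2 / 4 := fun j => by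
      ring
    simp_rw [e, sum_sub_distrib, ← mul_sum, ← sum_div]
    rw [Fin.sum_univ_succ (fun i => δ i ^ 2)]
    simp only [sum_const, card_univ, Fintype.card_fin, nsmul_eq_mul]
    linear_combination (-(s - δ 0 / 2)) * hδ0
  have hd0 : δ 0 = -(B - θ 0) := by
    simp only [hδ, hθs0]
    ring
  have hs4 : s ≤ 1 / 4 := sigmoid_deriv_le _
  rw [h3, hd0] at h2
  have h4 : s * ((n + 1) * (B - θ 0)) ≤ 1 / 4 * ((n + 1) * (B - θ 0)) := by gcongr
  have h5 : (n + 1) * (B - θ 0) * (B - θ 0) ≤ (n + 1) * (B - θ 0) * (2 * B) := by gcongr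
  linarith

/-- Pointwise bound used both near and away from the corner parameter. -/
lemma abs_score_zero_sub_le (hn : 0 < n) (hk : 0 < k) (hB : 0 < B) {w : BTLOutcome (n + 1) k}
    {θ : Fin (n + 1) → ℝ} (hθ : θ ∈ paramSet (n + 1) B)
    (hmin : ∀ θ' ∈ paramSet (n + 1) B,
      nll (n + 1) k (winFrac (n + 1) k w) θ ≤ nll (n + 1) k (winFrac (n + 1) k w) θ')
    {r : ℝ} (hr : 0 < r) :
    (|score (n + 1) k (cornerParam n B) w 0| - score (n + 1) k (cornerParam n B) w 0) / 2
      ≤ (1 + 2 * B) / 4 * (n + 1) * (B - θ 0)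
        + (1 / 4 + r / B ^ 2) * ∑ i, (θ i - cornerParam n B i) ^ 2
        + score (n + 1) k (cornerParam n B) w 0 ^ 2 / r := by
  have hl := neg_score_zero_le hn hk hB hθ hmin
  set S := score (n + 1) k (cornerParam n B) w 0
  set N := ∑ i, (θ i - cornerParam n B i) ^ 2 with hNdef
  have hN0 : 0 ≤ N := sum_nonneg fun i _ => sq_nonneg _
  have hX : 0 ≤ B - θ 0 := sub_nonneg.2 ((abs_le.1 ((norm_le_pi_norm θ 0).trans hθ.1)).2)
  have hD : 0 ≤ (1 + 2 * B) / 4 * (n + 1) * (B - θ 0) := by positivity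
  have hS : 0 ≤ S ^ 2 / r := by positivity
  have hrN : 0 ≤ r / B ^ 2 * N := by positivity
  by_cases hN : N ≤ B ^ 2 / 4
  · have := hl hN
    rcases abs_cases S with ⟨h, _⟩ | ⟨h, _⟩ <;> rw [h] <;> linarith
  · have h1 : r / 4 ≤ r / B ^ 2 * N := by
      have h2 : B ^ 2 / 4 ≤ N := (not_le.1 hN).le
      calc r / 4 = r / B ^ 2 * (B ^ 2 / 4) := by field_simp
        _ ≤ _ := by gcongr
    have h3 : |S| ≤ S ^ 2 / r + r / 4 := by
      rw [← sq_abs S]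
      have : 0 ≤ (|S| - r / 2) ^ 2 / r := by positivity
      have e : (|S| - r / 2) ^ 2 / r = |S| ^ 2 / r + r / 4 - |S| := by
        field_simp
        ring
      linarith
    linarith [neg_abs_le S]

end Score

section Moments

variable {d n k : ℕ}

lemma outcomeProb_nonneg (θ : Fin d → ℝ) (w : BTLOutcome d k) : 0 ≤ outcomeProb d k θ w :=
  prod_nonneg fun _ _ => binomProb_nonneg (sigmoid_pos _).le (sigmoid_lt_one _).le _

lemma sum_outcomeProb (θ : Fin d → ℝ) : ∑ w : BTLOutcome d k, outcomeProb d k θ w = 1 := by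
  unfold outcomeProb
  rw [← Fintype.prod_sum fun (q : {q : Fin d × Fin d // q.1 < q.2}) (x : Fin (k + 1)) =>
    binomProb k (sigmoid (θ q.1.1 - θ q.1.2)) x]
  simp [sum_binomProb]

lemma sum_outcomeProb_mul_score (hk : 0 < k) (θ : Fin d → ℝ) (i : Fin d) :
    ∑ w : BTLOutcome d k, outcomeProb d k θ w * score d k θ w i = 0 := by
  simp_rw [score, mul_sum]
  rw [sum_comm]
  refine sum_eq_zero fun q _ => ?_
  simp_rw [mul_left_comm _ (incidence i q)]
  rw [← mul_sum]
  have := sum_prod_mul_apply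
    (P := fun (q : {q : Fin d × Fin d // q.1 < q.2}) (x : Fin (k + 1)) =>
      binomProb k (sigmoid (θ q.1.1 - θ q.1.2)) x) (fun q => sum_binomProb k _) q
    fun x => (x : ℝ) / k - sigmoid (θ q.1.1 - θ q.1.2)
  rw [sum_binomProb_centered hk] at this
  rw [mul_eq_zero]
  exact Or.inr this

lemma sum_outcomeProb_mul_score_sq_le (hk : 0 < k) (θ : Fin d → ℝ) (i : Fin d) :
    ∑ w : BTLOutcome d k, outcomeProb d k θ w * score d k θ w i ^ 2
      ≤ ∑ q, incidence i q ^ 2 * (1 / (4 * k)) := by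
  have := sum_prod_mul_sq
    (P := fun (q : {q : Fin d × Fin d // q.1 < q.2}) (x : Fin (k + 1)) =>
      binomProb k (sigmoid (θ q.1.1 - θ q.1.2)) x) (fun q => sum_binomProb k _)
    (fun q x => (x : ℝ) / k - sigmoid (θ q.1.1 - θ q.1.2))
    (fun q => sum_binomProb_centered hk _) (incidence i)
  refine (le_of_eq this).trans (sum_le_sum fun q _ => ?_)
  rw [sum_binomProb_sq hk]
  have h : sigmoid (θ q.1.1 - θ q.1.2) * (1 - sigmoid (θ q.1.1 - θ q.1.2)) / k
      ≤ 1 / 4 / k := by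
    gcongr
    exact sigmoid_deriv_le _
  rw [div_div] at h
  gcongr

lemma sum_outcomeProb_mul_score_zero_sq_le (hk : 0 < k) (θ : Fin (n + 1) → ℝ) :
    ∑ w : BTLOutcome (n + 1) k, outcomeProb (n + 1) k θ w * score (n + 1) k θ w 0 ^ 2
      ≤ (n + 1) / k := by
  refine (sum_outcomeProb_mul_score_sq_le hk θ 0).trans ?_
  have h : ∀ q : {q : Fin (n + 1) × Fin (n + 1) // q.1 < q.2},
      incidence 0 q ^ 2 * (1 / (4 * k)) = if q.1.1 = 0 then (1 / (4 * k) : ℝ) else 0 := fun q => by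
    have := Fin.ne_zero_of_lt q.2
    simp [incidence, this]
  simp_rw [h]
  rw [sum_pairs_first_eq_zero fun _ _ => (1 / (4 * k) : ℝ)]
  simp only [sum_const, card_univ, Fintype.card_fin, nsmul_eq_mul]
  have hk' : (0 : ℝ) < k := by positivity
  rw [← sub_nonneg]
  have : ((n : ℝ) + 1) / k - n * (1 / (4 * k)) = (3 * n + 4) / (4 * k) := by
    field_simp
    ring
  rw [this]
  positivity

lemma sum_outcomeProb_mul_sum_score_sq_le (hk : 0 < k) (θ : Fin d → ℝ) :
    ∑ w : BTLOutcome d k, outcomeProb d k θ w * ∑ i, score d k θ w i ^ 2 ≤ (d : ℝ) ^ 2 / k := by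
  simp_rw [mul_sum]
  rw [sum_comm]
  refine (sum_le_sum fun i _ => sum_outcomeProb_mul_score_sq_le hk θ i).trans ?_
  rw [sum_comm]
  have h : ∀ q : {q : Fin d × Fin d // q.1 < q.2},
      ∑ i, incidence i q ^ 2 * (1 / (4 * k)) ≤ (1 / k : ℝ) := fun q => by
    have h1 : ∀ i, incidence i q ^ 2
        ≤ 2 * (if q.1.1 = i then 1 else 0) + 2 * (if q.1.2 = i then (1 : ℝ) else 0) := fun i => by
      unfold incidence
      split_ifs <;> norm_num
    have h2 := sum_le_sum fun i (_ : i ∈ univ) => h1 i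
    rw [sum_add_distrib, ← mul_sum, ← mul_sum, sum_ite_eq, sum_ite_eq] at h2
    simp only [mem_univ, if_true] at h2
    rw [← sum_mul]
    calc _ ≤ (4 : ℝ) * (1 / (4 * k)) := by
          gcongr
          linarith
      _ = _ := by field_simp
  refine (sum_le_sum fun q _ => h q).trans ?_
  rw [sum_const, nsmul_eq_mul, mul_one_div]
  gcongr
  have : #(univ : Finset {q : Fin d × Fin d // q.1 < q.2}) ≤ d * d := by
    simpa using Fintype.card_subtype_le fun q : Fin d × Fin d => q.1 < q.2
  rw [sq]
  exact_mod_cast this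

lemma le_sum_outcomeProb_mul_abs_score_zero (hn : 0 < n) (hk : 0 < k) {R : ℝ}
    {θ : Fin (n + 1) → ℝ} (hθ : ∀ i j, |θ i - θ j| ≤ R) :
    √n * (1 - Real.exp (-(2 * sigmoid (-R) ^ 2 / Real.pi ^ 2))) / √k
      ≤ ∑ w : BTLOutcome (n + 1) k, outcomeProb (n + 1) k θ w * |score (n + 1) k θ w 0| := by
  have hk' : (0 : ℝ) < k := by positivity
  set Q : Finset {q : Fin (n + 1) × Fin (n + 1) // q.1 < q.2} := univ.filter fun q => q.1.1 = 0
    with hQ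
  have hcard : (#Q : ℝ) = n := by
    have := sum_pairs_first_eq_zero (n := n) fun _ _ => (1 : ℝ)
    rw [← sum_filter] at this
    simpa using this
  have hne : Q.Nonempty := by
    rw [← card_pos]
    have : (0 : ℝ) < #Q := by
      rw [hcard]
      positivity
    exact_mod_cast this
  have h := le_sum_prod_binomProb_abs hk
    (p := fun q : {q : Fin (n + 1) × Fin (n + 1) // q.1 < q.2} => sigmoid (θ q.1.1 - θ q.1.2))
    (fun q => (sigmoid_pos _).le) (fun q => (sigmoid_lt_one _).le) hne
    (sq_nonneg (sigmoid (-R))) fun q _ => sq_le_sigmoid_deriv (hθ _ _)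
  have he : ∀ w : BTLOutcome (n + 1) k,
      |∑ q ∈ Q, ((w q : ℝ) - k * sigmoid (θ q.1.1 - θ q.1.2))| = k * |score (n + 1) k θ w 0| := by
    intro w
    rw [← abs_of_pos hk', ← abs_mul, abs_of_pos hk', score_zero, ← sum_filter, mul_sum]
    congr 1
    refine sum_congr rfl fun q _ => ?_
    unfold winNoise
    field_simp
  simp_rw [he, mul_left_comm _ (k : ℝ)] at h
  rw [← mul_sum, hcard, Real.sqrt_mul (by positivity)] at h
  have hsk : (0 : ℝ) < √k := by positivity
  refine le_of_mul_le_mul_left ?_ hk'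
  refine le_trans (le_of_eq ?_) h
  have : (k : ℝ) = √k * √k := (Real.mul_self_sqrt hk'.le).symm
  field_simp
  rw [Real.sq_sqrt hk'.le]
  ring

end Moments

lemma div_le_of_moment_bounds {B c C m r s A X G V : ℝ} (hB : 0 < B) (hc : 0 < c) (hC : 0 < C)
    (hm : 0 < m) (hr1 : 1 ≤ r) (hs : 0 < s)
    (hsC : 8 * ((1 / 4 + 1 / B ^ 2) / m ^ 2 + 1) / c ≤ s) (hA : r / 2 * c / s ≤ A)
    (h : A / 2 ≤ C * r ^ 2 * X + (1 / 4 + r / B ^ 2) / (m * r ^ 2) ^ 2 * G + V / r)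
    (hG0 : 0 ≤ G) (hG : G ≤ (r ^ 2) ^ 2 / s ^ 2) (hV : V ≤ r ^ 2 / s ^ 2) : c / (8 * C) / (r * s) ≤ X := by
  have hr : 0 < r := by linarith
  have h1 : (1 / 4 + r / B ^ 2) / (m * r ^ 2) ^ 2 * G
      ≤ (1 / 4 + 1 / B ^ 2) / m ^ 2 * (r / s ^ 2) := by
    calc _ ≤ (r / 4 + r / B ^ 2) / (m * r ^ 2) ^ 2 * ((r ^ 2) ^ 2 / s ^ 2) := by gcongr
      _ = _ := by
        field_simp
  have h2 : V / r ≤ r / s ^ 2 := by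
    rw [div_le_iff₀ hr]
    refine hV.trans (le_of_eq ?_)
    ring
  have h3 : ((1 / 4 + 1 / B ^ 2) / m ^ 2 + 1) * (r / s ^ 2) ≤ r * c / (8 * s) := by
    rw [div_le_iff₀ hc] at hsC
    generalize (1 / 4 + 1 / B ^ 2) / m ^ 2 + 1 = D at *
    rw [← mul_div_assoc, div_le_div_iff₀ (by positivity) (by positivity)]
    calc D * r * (8 * s) = 8 * D * (r * s) := by ring
      _ ≤ s * c * (r * s) := by gcongr
      _ = _ := by ring
  have h4 : r * c / (8 * s) ≤ C * r ^ 2 * X := by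
    have e : r / 2 * c / s / 2 = r * c / (8 * s) + r * c / (8 * s) := by
      field_simp
      ring
    linarith
  have h5 : c / (8 * C) / (r * s) * (C * r ^ 2) = r * c / (8 * s) := by
    field_simp
  refine le_of_mul_le_mul_right ?_ (by positivity : 0 < C * r ^ 2)
  rw [h5]
  linarith

/-- Theorem 1(a): the bias of the standard (box-constrained) MLE
is lower bounded as `Ω(1/√(dk))`: for every `B > 0` there are constants
`c > 0, d₀, k₀` depending only on `B` such that for all `d ≥ d₀`, `k ≥ k₀` and any
function `mle` selecting a minimizer of the negative log-likelihood over `Θ_B`,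
`sup_{θ* ∈ Θ_B} ‖E[θ̂⁽ᴮ⁾] − θ*‖_∞ ≥ c/√(dk)` (witnessed by some `θ* ∈ Θ_B`). -/
theorem mle_bias_lower_bound (B : ℝ) (hB : 0 < B) :
    ∃ c > (0 : ℝ), ∃ d₀ k₀ : ℕ, ∀ d k : ℕ, d₀ ≤ d → k₀ ≤ k →
      ∀ mle : BTLOutcome d k → Fin d → ℝ,
        (∀ w : BTLOutcome d k,
          mle w ∈ paramSet d B ∧
            ∀ θ ∈ paramSet d B,
              nll d k (winFrac d k w) (mle w) ≤ nll d k (winFrac d k w) θ) →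
        ∃ θstar ∈ paramSet d B,
          c / Real.sqrt ((d : ℝ) * k) ≤ ‖expVec d k θstar mle - θstar‖ := by
  set m := sigmoid (-(2 * B)) ^ 2 with hm
  have hm0 : 0 < m := pow_pos (sigmoid_pos _) 2
  set c₁ := 1 - Real.exp (-(2 * m / Real.pi ^ 2)) with hc₁
  have hc₁0 : 0 < c₁ := by
    have : 0 < 2 * m / Real.pi ^ 2 := by positivity
    exact sub_pos.2 (Real.exp_lt_one_iff.2 (neg_lt_zero.2 this))
  set C₁ := (1 + 2 * B) / 4 with hC₁
  have hC₁0 : 0 < C₁ := by positivity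
  set C₂ := (1 / 4 + 1 / B ^ 2) / m ^ 2 + 1 with hC₂
  have hC₂0 : 0 < C₂ := by positivity
  refine ⟨c₁ / (8 * C₁), by positivity, 2, ⌈(8 * C₂ / c₁) ^ 2⌉₊ + 1, ?_⟩
  intro d k hd hk mle hmle
  obtain ⟨n, rfl⟩ : ∃ n, d = n + 1 := ⟨d - 1, by omega⟩
  have hn : 0 < n := by omega
  have hk0 : 0 < k := by omega
  have hk0' : (0 : ℝ) < k := by positivity
  have hn1 : (1 : ℝ) ≤ n := by exact_mod_cast hn
  have hmem := cornerParam_mem hn hB.le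
  refine ⟨cornerParam n B, hmem, ?_⟩
  set θs := cornerParam n B with hθs
  set r := √((n : ℝ) + 1) with hr
  set s := √(k : ℝ) with hs
  have hr0 : 0 < r := by positivity
  have hs0 : 0 < s := by positivity
  have hr2 : r ^ 2 = n + 1 := Real.sq_sqrt (by positivity)
  have hs2 : s ^ 2 = k := Real.sq_sqrt (by positivity)
  have hr1 : 1 ≤ r := Real.one_le_sqrt.2 (by linarith)
  have hsC : 8 * C₂ / c₁ ≤ s := by
    refine Real.le_sqrt_of_sq_le ((Nat.le_ceil _).trans ?_)
    exact_mod_cast (Nat.le_succ _).trans hk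
  set p := outcomeProb (n + 1) k θs with hp
  set S : BTLOutcome (n + 1) k → ℝ := fun w => score (n + 1) k θs w 0 with hS
  set X : ℝ := ∑ w, p w * (B - mle w 0) with hX
  have hbias : X ≤ ‖expVec (n + 1) k θs mle - θs‖ := by
    have h1 : X = -((expVec (n + 1) k θs mle - θs) 0) := by
      simp_rw [hX, mul_sub, sum_sub_distrib, ← sum_mul, hp, sum_outcomeProb]
      simp [expVec, hθs, cornerParam]
    rw [h1]
    exact (neg_le_abs _).trans (norm_le_pi_norm (expVec (n + 1) k θs mle - θs) 0)
  have hlow : r / 2 * c₁ / s ≤ ∑ w, p w * |S w| := by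
    refine le_trans ?_ (le_sum_outcomeProb_mul_abs_score_zero hn hk0
      (abs_sub_le_of_mem_paramSet hmem))
    have : r / 2 ≤ √n := by
      refine Real.le_sqrt_of_sq_le ?_
      rw [div_pow, hr2]
      linarith
    gcongr
  have hpoint : ∀ w, p w * ((|S w| - S w) / 2) ≤ p w * (C₁ * (n + 1) * (B - mle w 0)
      + (1 / 4 + r / B ^ 2) * ((∑ i, score (n + 1) k θs w i ^ 2) / (m * (n + 1)) ^ 2)
      + S w ^ 2 / r) := fun w => by
    refine mul_le_mul_of_nonneg_left ?_ (outcomeProb_nonneg _ _)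
    refine (abs_score_zero_sub_le hn hk0 hB (hmle w).1 (hmle w).2 hr0).trans ?_
    have h := sum_sq_sub_le_score hk0 (hmle w).1 hmem (hmle w).2
    push_cast at h
    gcongr
    rw [le_div_iff₀ (by positivity), mul_comm]
    exact h
  have hsum := sum_le_sum fun w (_ : w ∈ univ) => hpoint w
  have hleft : ∑ w, p w * ((|S w| - S w) / 2) = (∑ w, p w * |S w|) / 2 := by
    simp_rw [← mul_div_assoc, mul_sub]
    rw [← sum_div, sum_sub_distrib, sum_outcomeProb_mul_score hk0, sub_zero]
  have hright : ∑ w, p w * (C₁ * (n + 1) * (B - mle w 0)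
      + (1 / 4 + r / B ^ 2) * ((∑ i, score (n + 1) k θs w i ^ 2) / (m * (n + 1)) ^ 2)
      + S w ^ 2 / r)
      = C₁ * (n + 1) * X + (1 / 4 + r / B ^ 2) / (m * (n + 1)) ^ 2
          * (∑ w, p w * ∑ i, score (n + 1) k θs w i ^ 2) + (∑ w, p w * S w ^ 2) / r := by
    rw [hX, mul_sum, mul_sum, sum_div, ← sum_add_distrib, ← sum_add_distrib]
    refine sum_congr rfl fun w _ => ?_
    ring
  rw [hleft, hright] at hsum
  have hΓ := sum_outcomeProb_mul_sum_score_sq_le hk0 θs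
  have hS2 := sum_outcomeProb_mul_score_zero_sq_le hk0 θs
  push_cast at hΓ
  refine le_trans ?_ hbias
  push_cast
  rw [Real.sqrt_mul (by positivity), ← hr, ← hs]
  rw [← hr2] at hsum hΓ hS2
  rw [← hs2] at hΓ hS2
  exact div_le_of_moment_bounds hB hc₁0 hC₁0 hm0 hr1 hs0 hsC hlow hsum
    (sum_nonneg fun w _ => mul_nonneg (outcomeProb_nonneg _ _) (sum_nonneg fun i _ => sq_nonneg _))
    hΓ hS2
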